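/- arXiv:2602.19445 — 2 statements merged into one kernel-verified Lean document; each statement's English description precedes it below -/
import Mathlib

section
/- The image of ℤ^8 under the SL3 pants coordinate change P is exactly the set of integer vectors (n11, n12, n21, n22, n31, n32, tP, hP) ∈ ℤ^8 satisfying the four congruence conditions: n12 + n22 + n32 ≡ n11 + n21 + n31 (mod 3); hP + n11 + n21 + n31 ≡ 0 (mod 2); hP ≡ n11 − n12 − n21 + n22 (mod 3); and 3·tP ≡ n12 + n22 + n32 − n11 − n21 − n31 (mod 6). Moreover, P is injective on ℤ^8. -/
/-- The SL3 pants coordinate change on `ℤ^8`. -/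
def PpantsZ : ℤ × ℤ × ℤ × ℤ × ℤ × ℤ × ℤ × ℤ → ℤ × ℤ × ℤ × ℤ × ℤ × ℤ × ℤ × ℤ
  | (x11, x12, x21, x22, x31, x32, xv, xv') =>
    (x11 + x32,
     x12 + x31 + xv + xv',
     x31 + x22,
     x32 + x21 + xv + xv',
     x21 + x12,
     x22 + x11 + xv + xv',
     xv - xv',
     x11 - x12 + x21 - x22 + x31 - x32)

/-- The four congruence conditions on `(n11, n12, n21, n22, n31, n32, tP, hP)`. -/
def pantsCongruences : ℤ × ℤ × ℤ × ℤ × ℤ × ℤ × ℤ × ℤ → Prop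
  | (n11, n12, n21, n22, n31, n32, tP, hP) =>
    (n12 + n22 + n32 ≡ n11 + n21 + n31 [ZMOD 3]) ∧
    (hP + n11 + n21 + n31 ≡ 0 [ZMOD 2]) ∧
    (hP ≡ n11 - n12 - n21 + n22 [ZMOD 3]) ∧
    (3 * tP ≡ n12 + n22 + n32 - n11 - n21 - n31 [ZMOD 6])

theorem PpantsZ_range_and_injective :
    Set.range PpantsZ = { y : ℤ × ℤ × ℤ × ℤ × ℤ × ℤ × ℤ × ℤ | pantsCongruences y } ∧
    Function.Injective PpantsZ := by
  constructor
  · ext ⟨n11, n12, n21, n22, n31, n32, t, h⟩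
    simp only [Set.mem_range, Set.mem_ofPred_eq, pantsCongruences, Int.ModEq]
    constructor
    · rintro ⟨⟨a, b, c, d, e, f, v, w⟩, hx⟩
      simp only [PpantsZ, Prod.mk.injEq] at hx
      obtain ⟨h1, h2, h3, h4, h5, h6, h7, h8⟩ := hx
      subst h1 h2 h3 h4 h5 h6 h7 h8
      refine ⟨?_, ?_, ?_, ?_⟩ <;> omega
    · rintro ⟨h1, h2, h3, h4⟩
      obtain ⟨S, hS⟩ : ∃ S, n12 + n22 + n32 - n11 - n21 - n31 = 3 * S :=
        ⟨(n12 + n22 + n32 - n11 - n21 - n31) / 3, by omega⟩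
      obtain ⟨T, hT⟩ : ∃ T, h + n11 + n21 + n31 = 2 * T :=
        ⟨(h + n11 + n21 + n31) / 2, by omega⟩
      obtain ⟨v, hv⟩ : ∃ v, S + t = 2 * v := ⟨(S + t) / 2, by omega⟩
      obtain ⟨c, hc⟩ : ∃ c, T - (n12 - S - n31) + (n22 - S - n11) = 3 * c :=
        ⟨(T - (n12 - S - n31) + (n22 - S - n11)) / 3, by omega⟩
      refine ⟨(c - (n22 - S - n11), n31 - c, c, n21 - (c + (n12 - S - n31)),
        c + (n12 - S - n31), n11 - (c - (n22 - S - n11)), v, v - t), ?_⟩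
      simp only [PpantsZ, Prod.mk.injEq]
      refine ⟨?_, ?_, ?_, ?_, ?_, ?_, ?_, ?_⟩ <;> linarith
  · rintro ⟨a, b, c, d, e, f, v, w⟩ ⟨a', b', c', d', e', f', v', w'⟩ hx
    simp only [PpantsZ, Prod.mk.injEq] at hx ⊢
    obtain ⟨h1, h2, h3, h4, h5, h6, h7, h8⟩ := hx
    refine ⟨?_, ?_, ?_, ?_, ?_, ?_, ?_, ?_⟩ <;> linarith
end

section
/- The image of the set Λ under the SL3 pants coordinate change P is exactly the set of integer vectors (n11, n12, n21, n22, n31, n32, tP, hP) ∈ ℤ^8 satisfying: n11 ≥ 0, n12 ≥ 0, n21 ≥ 0, n22 ≥ 0, n31 ≥ 0, n32 ≥ 0; n12 + n22 + n32 ≡ n11 + n21 + n31 (mod 3); hP + n11 + n21 + n31 ≡ 0 (mod 2); hP ≡ n11 − n12 − n21 + n22 (mod 3); and 3·tP ≡ n12 + n22 + n32 − n11 − n21 − n31 (mod 6). -/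
/-- The set `Λ` of shear coordinates of unbounded SL3-laminations on the
thrice-punctured sphere. -/
def LambdaSet : Set (ℤ × ℤ × ℤ × ℤ × ℤ × ℤ × ℤ × ℤ) :=
  { x | match x with
        | (x11, x12, x21, x22, x31, x32, xv, xv') =>
          0 ≤ x11 + x32 ∧
          0 ≤ x12 + x31 + xv + xv' ∧
          0 ≤ x31 + x22 ∧
          0 ≤ x32 + x21 + xv + xv' ∧
          0 ≤ x21 + x12 ∧
          0 ≤ x22 + x11 + xv + xv' }

/-- Nonnegativity together with the four congruence conditions. -/
def pantsImageConditions : ℤ × ℤ × ℤ × ℤ × ℤ × ℤ × ℤ × ℤ → Prop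
  | (n11, n12, n21, n22, n31, n32, tP, hP) =>
    0 ≤ n11 ∧ 0 ≤ n12 ∧ 0 ≤ n21 ∧ 0 ≤ n22 ∧ 0 ≤ n31 ∧ 0 ≤ n32 ∧
    (n12 + n22 + n32 ≡ n11 + n21 + n31 [ZMOD 3]) ∧
    (hP + n11 + n21 + n31 ≡ 0 [ZMOD 2]) ∧
    (hP ≡ n11 - n12 - n21 + n22 [ZMOD 3]) ∧
    (3 * tP ≡ n12 + n22 + n32 - n11 - n21 - n31 [ZMOD 6])

theorem PpantsZ_image_Lambda :
    PpantsZ '' LambdaSet =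
      { y : ℤ × ℤ × ℤ × ℤ × ℤ × ℤ × ℤ × ℤ | pantsImageConditions y } := by
  ext ⟨n11, n12, n21, n22, n31, n32, t, h⟩
  constructor
  · rintro ⟨⟨x11, x12, x21, x22, x31, x32, xv, xv'⟩, hx, he⟩
    simp only [LambdaSet, Set.mem_setOf_eq] at hx
    simp only [PpantsZ, Prod.mk.injEq] at he
    simp only [Set.mem_setOf_eq, pantsImageConditions, Int.ModEq]
    obtain ⟨h1, h2, h3, h4, h5, h6⟩ := hx
    obtain ⟨rfl, rfl, rfl, rfl, rfl, rfl, rfl, rfl⟩ := he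
    refine ⟨h1, h2, h3, h4, h5, h6, ?_, ?_, ?_, ?_⟩ <;> omega
  · intro hy
    simp only [Set.mem_setOf_eq, pantsImageConditions, Int.ModEq] at hy
    obtain ⟨h1, h2, h3, h4, h5, h6, c1, c2, c3, c4⟩ := hy
    obtain ⟨s, hs⟩ : ∃ s, n12 + n22 + n32 - n11 - n21 - n31 = 3 * s :=
      ⟨(n12 + n22 + n32 - n11 - n21 - n31) / 3, by omega⟩
    obtain ⟨v, hv⟩ : ∃ v, s + t = 2 * v := ⟨(s + t) / 2, by omega⟩
    obtain ⟨a, ha⟩ : ∃ a, h + n11 + n21 + n31 = 2 * a :=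
      ⟨(h + n11 + n21 + n31) / 2, by omega⟩
    obtain ⟨b, hb⟩ : ∃ b, a - (n12 - n31) + (n22 - n11) = 3 * b :=
      ⟨(a - (n12 - n31) + (n22 - n11)) / 3, by omega⟩
    refine ⟨(b - (n22 - s - n11), n31 - b, b, n21 - (b + (n12 - s - n31)),
      b + (n12 - s - n31), n11 - (b - (n22 - s - n11)), v, s - v), ?_, ?_⟩
    · simp only [LambdaSet, Set.mem_setOf_eq]
      refine ⟨?_, ?_, ?_, ?_, ?_, ?_⟩ <;> omega
    · simp only [PpantsZ, Prod.mk.injEq]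
      refine ⟨?_, ?_, ?_, ?_, ?_, ?_, ?_, ?_⟩ <;> omega
end
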